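/- arXiv:1805.04495 — 4 statements merged into one kernel-verified Lean document; each statement's English description precedes it below -/
import Mathlib

section
/- Let N be a positive integer, let a ≤ b be real numbers, and let g : ℝ → ℝ^N be differentiable on [a,b] with derivative g' that is integrable on [a,b]. Then for every t ∈ [a,b], ‖g(t)‖ ≤ (1/2)·∫_a^b ‖g'(s)‖ ds + (1/2)·‖g(a) + g(b)‖, where ‖·‖ denotes the Euclidean norm; in particular, sup_{t∈[a,b]} ‖g(t)‖ ≤ (1/2)·∫_a^b ‖g'(s)‖ ds + (1/2)·‖g(a) + g(b)‖. -/
open Set MeasureTheory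

/-- The increment of a differentiable function is bounded by the integral of the norm of its
derivative. -/
theorem norm_sub_le_integral_norm_of_hasDerivWithinAt {E : Type*} [NormedAddCommGroup E]
    [NormedSpace ℝ E] [CompleteSpace E] {f f' : ℝ → E} {a b : ℝ} (hab : a ≤ b)
    (hderiv : ∀ t ∈ Icc a b, HasDerivWithinAt f (f' t) (Icc a b) t)
    (hint : IntervalIntegrable f' volume a b) :
    ‖f b - f a‖ ≤ ∫ s in a..b, ‖f' s‖ := by
  rw [← intervalIntegral.integral_eq_sub_of_hasDerivAt_of_le hab
    (fun t ht => (hderiv t ht).continuousWithinAt)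
    (fun t ht => (hderiv t (Ioo_subset_Icc_self ht)).hasDerivAt (Icc_mem_nhds ht.1 ht.2)) hint]
  exact intervalIntegral.norm_integral_le_integral_norm hab

/-- A differentiable function on `[a, b]` is bounded by half the integral of the norm of its
derivative plus half the norm of the sum of its endpoint values. -/
theorem norm_le_half_integral_norm_add_half_norm_add {E : Type*} [NormedAddCommGroup E]
    [NormedSpace ℝ E] [CompleteSpace E] {f f' : ℝ → E} {a b t : ℝ} (ht : t ∈ Icc a b)
    (hderiv : ∀ t ∈ Icc a b, HasDerivWithinAt f (f' t) (Icc a b) t)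
    (hint : IntervalIntegrable f' volume a b) :
    ‖f t‖ ≤ (1/2) * (∫ s in a..b, ‖f' s‖) + (1/2) * ‖f a + f b‖ := by
  have hat : Icc a t ⊆ Icc a b := Icc_subset_Icc_right ht.2
  have htb : Icc t b ⊆ Icc a b := Icc_subset_Icc_left ht.1
  have hint_left : IntervalIntegrable f' volume a t :=
    hint.mono_set (by rwa [uIcc_of_le ht.1, uIcc_of_le (ht.1.trans ht.2)])
  have hint_right : IntervalIntegrable f' volume t b :=
    hint.mono_set (by rwa [uIcc_of_le ht.2, uIcc_of_le (ht.1.trans ht.2)])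
  have hleft := norm_sub_le_integral_norm_of_hasDerivWithinAt ht.1
    (fun s hs => (hderiv s (hat hs)).mono hat) hint_left
  have hright := norm_sub_le_integral_norm_of_hasDerivWithinAt ht.2
    (fun s hs => (hderiv s (htb hs)).mono htb) hint_right
  have hsplit := intervalIntegral.integral_add_adjacent_intervals hint_left.norm hint_right.norm
  have htwo : ‖f t + f t‖ = 2 * ‖f t‖ := by
    rw [← two_smul ℝ (f t), norm_smul, Real.norm_ofNat]
  have htriangle : ‖f t + f t‖ ≤ ‖f t - f a‖ + ‖f b - f t‖ + ‖f a + f b‖ :=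
    calc ‖f t + f t‖ = ‖(f t - f a) - (f b - f t) + (f a + f b)‖ := by congr 1; abel
      _ ≤ _ := (norm_add_le _ _).trans (by gcongr; exact norm_sub_le _ _)
  linarith

/-- Lemma 2: for a differentiable vector-valued function `g` on `[a,b]` with
integrable derivative `g'`, every value (and hence the supremum of `‖g‖`) is
bounded by `(1/2)∫_a^b ‖g'‖ + (1/2)‖g a + g b‖`. -/
theorem stmt_0 (N : ℕ) (hN : 0 < N) (a b : ℝ) (hab : a ≤ b)
    (g g' : ℝ → EuclideanSpace ℝ (Fin N))
    (hderiv : ∀ t ∈ Icc a b, HasDerivWithinAt g (g' t) (Icc a b) t)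
    (hint : IntervalIntegrable g' volume a b) :
    (∀ t ∈ Icc a b,
      ‖g t‖ ≤ (1/2) * (∫ s in a..b, ‖g' s‖) + (1/2) * ‖g a + g b‖) ∧
    (⨆ t : Icc a b, ‖g t.1‖) ≤
      (1/2) * (∫ s in a..b, ‖g' s‖) + (1/2) * ‖g a + g b‖ := by
  have hbound : ∀ t ∈ Icc a b,
      ‖g t‖ ≤ (1/2) * (∫ s in a..b, ‖g' s‖) + (1/2) * ‖g a + g b‖ :=
    fun t ht => norm_le_half_integral_norm_add_half_norm_add ht hderiv hint
  have : Nonempty (Icc a b) := ⟨⟨a, left_mem_Icc.2 hab⟩⟩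
  exact ⟨hbound, ciSup_le fun t => hbound t.1 t.2⟩
end

section
/- Let n, m be positive integers and let P be a real symmetric positive-definite n×n matrix; define the P-weighted norm ‖v‖_P := √(vᵀ P v) for v ∈ ℝⁿ, and let λ̄(√P) := √(λ_max(P)) be the largest eigenvalue of the positive-definite square root of P. Let L > 0, ρ > 0, β ∈ (0,1), T > 0, and let a ≤ b with β·T ≤ b − a. Let f : ℝⁿ × ℝ^m → ℝⁿ satisfy ‖f(z₁,v) − f(z₂,v)‖_P ≤ L·‖z₁ − z₂‖_P for all z₁, z₂, v; let u : ℝ → ℝ^m and ω : ℝ → ℝⁿ with Euclidean norm ‖ω(t)‖ ≤ ρ for all t ∈ [a,b]. Suppose x, y : ℝ → ℝⁿ satisfy x(a) = y(a), and for every t ∈ [a,b], x has derivative f(x(t),u(t)) + ω(t) at t and y has derivative f(y(t),u(t)) at t. Define the triggering level δ := ρ·λ̄(√P)·[ e^{LβT}·( βT/L − 1/L² ) + 1/L² ]. Then for every h ∈ [0, βT), ∫_a^{a+h} ‖x(s) − y(s)‖_P ds < δ; consequently, if h ∈ (0, b−a] satisfies ∫_a^{a+h} ‖x(s) − y(s)‖_P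 ds = δ, then h ≥ β·T. -/
open Set Matrix MeasureTheory

/-- The Euclidean norm on `ℝⁿ` (vectors as `Fin n → ℝ`). -/
noncomputable def eucNorm {n : ℕ} (v : Fin n → ℝ) : ℝ :=
  Real.sqrt (∑ i, (v i) ^ 2)

/-- The `P`-weighted norm `‖v‖_P = √(vᵀ P v)`. -/
noncomputable def pNorm {n : ℕ} (P : Matrix (Fin n) (Fin n) ℝ) (v : Fin n → ℝ) : ℝ :=
  Real.sqrt (v ⬝ᵥ P.mulVec v)

open scoped MatrixOrder in
lemma Matrix.PosSemidef.exists_pNorm_eq_norm {n : ℕ} {P : Matrix (Fin n) (Fin n) ℝ}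
    (hP : P.PosSemidef) :
    ∃ B : (Fin n → ℝ) →L[ℝ] EuclideanSpace ℝ (Fin n), ∀ v, pNorm P v = ‖B v‖ := by
  obtain ⟨C, rfl⟩ := CStarAlgebra.nonneg_iff_eq_star_mul_self.mp hP.nonneg
  refine ⟨(EuclideanSpace.equiv (Fin n) ℝ).symm.toContinuousLinearMap ∘L
    LinearMap.toContinuousLinearMap C.mulVecLin, fun v => ?_⟩
  rw [pNorm, EuclideanSpace.norm_eq, star_eq_conjTranspose, ← mulVec_mulVec,
    dotProduct_mulVec, conjTranspose_eq_transpose_of_trivial, vecMul_transpose]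
  simp [dotProduct, sq]

open scoped MatrixOrder in
lemma Matrix.IsHermitian.pNorm_le_sqrt_iSup_eigenvalues_mul_eucNorm {n : ℕ}
    {P : Matrix (Fin n) (Fin n) ℝ} (hP : P.IsHermitian) (v : Fin n → ℝ) :
    pNorm P v ≤ √(⨆ i, hP.eigenvalues i) * eucNorm v := by
  have hle : P ≤ algebraMap ℝ _ (⨆ i, hP.eigenvalues i) := by
    refine le_algebraMap_of_spectrum_le (fun r hr => ?_) hP.isSelfAdjoint
    obtain ⟨i, rfl⟩ := hP.spectrum_real_eq_range_eigenvalues ▸ hr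
    exact le_ciSup (Set.finite_range _).bddAbove i
  have hquad := (Matrix.le_iff.mp hle).dotProduct_mulVec_nonneg v
  rw [pNorm, eucNorm, ← Real.sqrt_mul' _ (Finset.sum_nonneg fun i _ => sq_nonneg (v i))]
  apply Real.sqrt_le_sqrt
  rw [Algebra.algebraMap_eq_smul_one, sub_mulVec, dotProduct_sub, smul_mulVec, one_mulVec,
    dotProduct_smul] at hquad
  simpa [dotProduct, sq] using hquad

lemma hasDerivAt_exp_mul_mul_sub {L : ℝ} (hL : L ≠ 0) (a s : ℝ) :
    HasDerivAt (fun s => Real.exp (L * (s - a)) * ((s - a) / L - 1 / L ^ 2) + 1 / L ^ 2)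
      ((s - a) * Real.exp (L * (s - a))) s := by
  have hlin : HasDerivAt (fun s => s - a) 1 s := (hasDerivAt_id s).sub_const a
  convert! ((hlin.const_mul L).exp.mul ((hlin.div_const L).sub_const (1 / L ^ 2))).add_const
    (1 / L ^ 2) using 1
  field_simp
  ring

lemma integral_sub_mul_exp_mul_sub {L : ℝ} (hL : L ≠ 0) (a h : ℝ) :
    ∫ s in a..(a + h), (s - a) * Real.exp (L * (s - a)) =
      Real.exp (L * h) * (h / L - 1 / L ^ 2) + 1 / L ^ 2 := by
  rw [intervalIntegral.integral_eq_sub_of_hasDerivAt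
    (fun s _ => hasDerivAt_exp_mul_mul_sub hL a s)
    (Continuous.intervalIntegrable (by fun_prop) _ _)]
  simp

lemma strictMonoOn_exp_mul_mul_sub {L : ℝ} (hL : L ≠ 0) :
    StrictMonoOn (fun s => Real.exp (L * s) * (s / L - 1 / L ^ 2) + 1 / L ^ 2) (Ici 0) := by
  refine strictMonoOn_of_deriv_pos (convex_Ici 0) (by fun_prop) fun s hs => ?_
  rw [interior_Ici, mem_Ioi] at hs
  have hderiv := hasDerivAt_exp_mul_mul_sub hL 0 s
  simp only [sub_zero] at hderiv
  rw [hderiv.deriv]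
  positivity

lemma gronwallBound_zero_le {L c : ℝ} (hL : 0 < L) (hc : 0 ≤ c) (t : ℝ) :
    gronwallBound 0 L c t ≤ c * (t * Real.exp (L * t)) := by
  rw [gronwallBound_of_K_ne_0 hL.ne']
  have hexp : Real.exp (L * t) - 1 ≤ L * t * Real.exp (L * t) := by
    have h := mul_le_mul_of_nonneg_right (Real.add_one_le_exp (-(L * t))) (Real.exp_pos (L * t)).le
    rw [← Real.exp_add, neg_add_cancel, Real.exp_zero] at h
    linarith
  calc 0 * Real.exp (L * t) + c / L * (Real.exp (L * t) - 1)
      ≤ c / L * (L * t * Real.exp (L * t)) := by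
        rw [zero_mul, zero_add]
        gcongr
    _ = c * (t * Real.exp (L * t)) := by field_simp

/-- Theorem 1, part 2: with the triggering level
`δ = ρ λ̄(√P) [e^{LβT}(βT/L - 1/L²) + 1/L²]`, the integral of the `P`-weighted
error stays below `δ` before time `a + βT`; hence any triggering time `h`
(where the integral equals `δ`) satisfies `h ≥ βT`. -/
theorem stmt_5 (n m : ℕ) (hn : 0 < n) (hm : 0 < m)
    (P : Matrix (Fin n) (Fin n) ℝ) (hP : P.IsHermitian) (hPpos : P.PosDef)
    (L ρ β T : ℝ) (hL : 0 < L) (hρ : 0 < ρ) (hβ : β ∈ Ioo (0:ℝ) 1) (hT : 0 < T)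
    (a b : ℝ) (hab : a ≤ b) (hbT : β * T ≤ b - a)
    (f : (Fin n → ℝ) → (Fin m → ℝ) → (Fin n → ℝ))
    (hf : ∀ z₁ z₂ v, pNorm P (f z₁ v - f z₂ v) ≤ L * pNorm P (z₁ - z₂))
    (u : ℝ → Fin m → ℝ) (ω : ℝ → Fin n → ℝ)
    (hω : ∀ t ∈ Icc a b, eucNorm (ω t) ≤ ρ)
    (x y : ℝ → Fin n → ℝ) (hinit : x a = y a)
    (hx : ∀ t ∈ Icc a b, HasDerivAt x (f (x t) (u t) + ω t) t)
    (hy : ∀ t ∈ Icc a b, HasDerivAt y (f (y t) (u t)) t)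
    (δ : ℝ)
    (hδ : δ = ρ * Real.sqrt (⨆ i, hP.eigenvalues i) *
      (Real.exp (L * β * T) * (β * T / L - 1 / L ^ 2) + 1 / L ^ 2)) :
    (∀ h ∈ Ico (0:ℝ) (β * T), (∫ s in a..(a + h), pNorm P (x s - y s)) < δ) ∧
    (∀ h : ℝ, 0 < h → h ≤ b - a →
      (∫ s in a..(a + h), pNorm P (x s - y s)) = δ → β * T ≤ h) := by
  obtain ⟨B, hB⟩ := hPpos.posSemidef.exists_pNorm_eq_norm
  have hmax : 0 < ⨆ i, hP.eigenvalues i :=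
    (hPpos.eigenvalues_pos ⟨0, hn⟩).trans_le
      (le_ciSup (f := hP.eigenvalues) (Set.finite_range _).bddAbove ⟨0, hn⟩)
  set c := ρ * √(⨆ i, hP.eigenvalues i) with hc
  have hcpos : 0 < c := mul_pos hρ (Real.sqrt_pos.mpr hmax)
  have hderiv : ∀ t ∈ Icc a b, HasDerivAt (fun t => B (x t - y t))
      (B (f (x t) (u t) + ω t - f (y t) (u t))) t := fun t ht =>
    B.hasFDerivAt.comp_hasDerivAt t ((hx t ht).sub (hy t ht))
  have hcont : ContinuousOn (fun t => B (x t - y t)) (Icc a b) := fun t ht =>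
    (hderiv t ht).continuousAt.continuousWithinAt
  have hbound : ∀ t ∈ Ico a b, ‖B (f (x t) (u t) + ω t - f (y t) (u t))‖ ≤
      L * ‖B (x t - y t)‖ + c := by
    intro t ht
    have hlip := hf (x t) (y t) (u t)
    have hdist : pNorm P (ω t) ≤ c := by
      refine (hP.pNorm_le_sqrt_iSup_eigenvalues_mul_eucNorm (ω t)).trans ?_
      rw [hc, mul_comm ρ]
      gcongr
      exact hω t (Ico_subset_Icc_self ht)
    rw [hB] at hlip hdist
    rw [hB] at hlip
    rw [add_sub_right_comm, map_add]
    exact (norm_add_le _ _).trans (add_le_add hlip hdist)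
  have herr : ∀ t ∈ Icc a b, ‖B (x t - y t)‖ ≤ c * ((t - a) * Real.exp (L * (t - a))) :=
    fun t ht => (norm_le_gronwallBound_of_norm_deriv_right_le hcont
      (fun s hs => (hderiv s (Ico_subset_Icc_self hs)).hasDerivWithinAt)
      (by simp [hinit]) hbound t ht).trans (gronwallBound_zero_le hL hcpos.le _)
  have hlt : ∀ h ∈ Ico (0 : ℝ) (β * T), (∫ s in a..(a + h), pNorm P (x s - y s)) < δ := by
    intro h hh
    have hah : a ≤ a + h := le_add_of_nonneg_right hh.1
    have hsub : Icc a (a + h) ⊆ Icc a b := Icc_subset_Icc_right (by linarith [hh.2])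
    simp only [hB]
    calc ∫ s in a..(a + h), ‖B (x s - y s)‖
        ≤ ∫ s in a..(a + h), c * ((s - a) * Real.exp (L * (s - a))) :=
          intervalIntegral.integral_mono_on hah
            ((hcont.mono hsub).norm.intervalIntegrable_of_Icc hah)
            (Continuous.intervalIntegrable (by fun_prop) _ _)
            fun s hs => herr s (hsub hs)
      _ = c * (Real.exp (L * h) * (h / L - 1 / L ^ 2) + 1 / L ^ 2) := by
          rw [intervalIntegral.integral_const_mul, integral_sub_mul_exp_mul_sub hL.ne']
      _ < c * (Real.exp (L * (β * T)) * (β * T / L - 1 / L ^ 2) + 1 / L ^ 2) :=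
          mul_lt_mul_of_pos_left (strictMonoOn_exp_mul_mul_sub hL.ne' hh.1
            (hh.1.trans hh.2.le) hh.2) hcpos
      _ = δ := by rw [hδ, mul_assoc L]
  exact ⟨hlt, fun h h0 _ heq => not_lt.mp fun hh => (hlt h ⟨h0.le, hh⟩).ne heq⟩
end

section
/- Let L > 0 and c > 0 be real numbers with L·c > 1. Then for every real h ≥ c, h·e^{Lh} ≤ ( L²·c / (L·c − 1) ) · ( e^{Lh}·( h/L − 1/L² ) + 1/L² ). -/
/-- Key algebraic estimate in Corollary 1: for `Lc > 1` and `h ≥ c`,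
`h e^{Lh} ≤ (L²c/(Lc - 1)) (e^{Lh}(h/L - 1/L²) + 1/L²)`. -/
theorem stmt_7 (L c : ℝ) (hL : 0 < L) (hc : 0 < c) (hLc : 1 < L * c) :
    ∀ h : ℝ, c ≤ h →
      h * Real.exp (L * h) ≤
        (L ^ 2 * c / (L * c - 1)) *
          (Real.exp (L * h) * (h / L - 1 / L ^ 2) + 1 / L ^ 2) := by
  intro h hch
  have hpos : 0 < L * c - 1 := sub_pos.mpr hLc
  have key : (L ^ 2 * c / (L * c - 1)) *
      (Real.exp (L * h) * (h / L - 1 / L ^ 2) + 1 / L ^ 2) =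
      c * (Real.exp (L * h) * (L * h - 1) + 1) / (L * c - 1) := by
    have hL0 : L ≠ 0 := hL.ne'
    field_simp
  rw [key, le_div_iff₀ hpos]
  linarith [mul_le_mul_of_nonneg_right hch (Real.exp_pos (L * h)).le]
end

section
/- Let T > 0, α ∈ (0,1), β ∈ (0,1), c > 0, and M ∈ ℝ be real numbers, and let Δ satisfy β·T ≤ Δ ≤ T. Assume c·β·T ≥ 2·ln(1/α) and M ≥ 1 − 1/β + 1/(α·β). Then for every τ ∈ [0, Δ], e^{−c·τ/2} ≤ ( (Δ − τ)·M + (T − Δ + τ) )·α / T. -/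
open Set

/-- Robustness-constraint inequality from Theorem 2, step 3: for
`τ ∈ [0, Δ]` with `βT ≤ Δ ≤ T`, `cβT ≥ 2 ln(1/α)` and
`M ≥ 1 - 1/β + 1/(αβ)`, one has
`e^{-cτ/2} ≤ ((Δ - τ) M + (T - Δ + τ)) α / T`. -/
theorem stmt_11 (T α β c M Δ : ℝ) (hT : 0 < T)
    (hα : α ∈ Ioo (0:ℝ) 1) (hβ : β ∈ Ioo (0:ℝ) 1) (hc : 0 < c)
    (hΔl : β * T ≤ Δ) (hΔu : Δ ≤ T)
    (hcond : 2 * Real.log (1 / α) ≤ c * β * T)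
    (hM : 1 - 1 / β + 1 / (α * β) ≤ M) :
    ∀ τ ∈ Icc (0:ℝ) Δ,
      Real.exp (-c * τ / 2) ≤ ((Δ - τ) * M + (T - Δ + τ)) * α / T := by
  rintro τ ⟨hτ0, hτΔ⟩
  obtain ⟨hα0, hα1⟩ := hα
  obtain ⟨hβ0, -⟩ := hβ
  have hΔ : 0 < Δ := (mul_pos hβ0 hT).trans_le hΔl
  obtain ⟨θ, hθ⟩ : ∃ θ, θ = τ / Δ := ⟨_, rfl⟩
  have hτ : τ = θ * Δ := by rw [hθ]; field_simp
  have hθ0 : 0 ≤ θ := hθ ▸ div_nonneg hτ0 hΔ.le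
  have hθ1 : θ ≤ 1 := hθ ▸ (div_le_one hΔ).2 hτΔ
  have hend : Real.exp (-c * Δ / 2) ≤ α := by
    rw [← Real.le_log_iff_exp_le hα0]
    rw [one_div, Real.log_inv] at hcond
    have : c * (β * T) ≤ c * Δ := mul_le_mul_of_nonneg_left hΔl hc.le
    linarith
  -- Convexity reduces the bound to the two endpoints of `[0, Δ]`.
  have hconv : Real.exp (-c * τ / 2) ≤ (1 - θ) + θ * Real.exp (-c * Δ / 2) := by
    have h := convexOn_exp.2 (mem_univ (0 : ℝ)) (mem_univ (-c * Δ / 2))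
      (sub_nonneg.2 hθ1) hθ0 (by ring)
    simp only [smul_eq_mul, mul_zero, zero_add, Real.exp_zero, mul_one] at h
    rwa [show -c * τ / 2 = θ * (-c * Δ / 2) by rw [hτ]; ring]
  have hslope : 1 - α ≤ α * β * (M - 1) := by
    have h := mul_le_mul_of_nonneg_left hM (mul_pos hα0 hβ0).le
    have e : α * β * (1 - 1 / β + 1 / (α * β)) = α * β - α + 1 := by field_simp
    rw [e] at h
    linarith
  have hM1 : 0 ≤ α * (M - 1) := by
    have : 0 < β * (α * (M - 1)) := by linarith
    exact (pos_of_mul_pos_right this hβ0.le).le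
  have hstart : T * (1 - α) ≤ Δ * (α * (M - 1)) := by
    have h₁ := mul_le_mul_of_nonneg_right hΔl hM1
    have h₂ := mul_le_mul_of_nonneg_left hslope hT.le
    linarith
  calc Real.exp (-c * τ / 2) ≤ (1 - θ) + θ * α :=
        hconv.trans (by gcongr)
    _ ≤ ((Δ - τ) * M + (T - Δ + τ)) * α / T := by
        rw [le_div_iff₀ hT, hτ]
        have := mul_le_mul_of_nonneg_left hstart (sub_nonneg.2 hθ1)
        linarith
end
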